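/- arXiv:quant-ph/0511170 — 13 statements merged into one kernel-verified Lean document; each statement's English description precedes it below -/
import Mathlib

section
/- Let ρ be a positive definite Hermitian d×d complex matrix and X a Hermitian d×d complex matrix. Suppose v₁,…,vₙ are vectors in ℂ^d and λ₁,…,λₙ are real numbers such that Σₓ vₓvₓ† = ρ and Σₓ λₓ vₓvₓ† = X. Then Σₓ λₓ² ‖vₓ‖² ≥ Tr(X ρ⁻¹ X). (That is, the classical Fisher information of any local reverse estimation of a one-parameter quantum state family is at least the RLD Fisher information.) -/
open scoped ComplexOrder

/-- A matrix form of the Cauchy–Schwarz inequality: `(W D Wᴴ) (W Wᴴ)⁻¹ (W D Wᴴ) ≤ W D² Wᴴ`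
in the Loewner order, for `D` Hermitian and `W Wᴴ` invertible. -/
theorem Matrix.IsHermitian.posSemidef_mul_sq_mul_conjTranspose_sub
    {m k : Type*} [Fintype m] [DecidableEq m] [Fintype k]
    (W : Matrix m k ℂ) {D : Matrix k k ℂ} (hD : D.IsHermitian)
    (hW : IsUnit (W * W.conjTranspose).det) :
    (W * (D * D) * W.conjTranspose -
      (W * D * W.conjTranspose) * (W * W.conjTranspose)⁻¹ *
        (W * D * W.conjTranspose)).PosSemidef := by
  set R := W * W.conjTranspose with hR
  set X := W * D * W.conjTranspose with hX
  have hRinv : (R⁻¹).conjTranspose = R⁻¹ :=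
    (Matrix.isHermitian_mul_conjTranspose_self W).inv
  have hXH : X.conjTranspose = X := Matrix.isHermitian_mul_mul_conjTranspose W hD
  have key : W * (D * D) * W.conjTranspose - X * R⁻¹ * X =
      (X * R⁻¹ * W - W * D) * (X * R⁻¹ * W - W * D).conjTranspose := by
    have hXW : (X * R⁻¹ * W) * (X * R⁻¹ * W).conjTranspose = X * R⁻¹ * X := by
      rw [Matrix.conjTranspose_mul, Matrix.conjTranspose_mul, hRinv, hXH]
      calc X * R⁻¹ * W * (W.conjTranspose * (R⁻¹ * X))
          = X * (R⁻¹ * R) * (R⁻¹ * X) := by rw [hR]; simp only [Matrix.mul_assoc]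
        _ = X * R⁻¹ * X := by
          rw [Matrix.nonsing_inv_mul R hW, Matrix.mul_one, Matrix.mul_assoc X]
    have hcross : (X * R⁻¹ * W) * (W * D).conjTranspose = X * R⁻¹ * X := by
      rw [Matrix.conjTranspose_mul, hD.eq]
      nth_rewrite 3 [hX]
      simp only [Matrix.mul_assoc]
    have hcross' : (W * D) * (X * R⁻¹ * W).conjTranspose = X * R⁻¹ * X := by
      rw [Matrix.conjTranspose_mul, Matrix.conjTranspose_mul, hRinv, hXH,
        ← Matrix.mul_assoc, ← Matrix.mul_assoc]
    have hsq : (W * D) * (W * D).conjTranspose = W * (D * D) * W.conjTranspose := by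
      rw [Matrix.conjTranspose_mul, hD.eq]
      simp only [Matrix.mul_assoc]
    rw [Matrix.conjTranspose_sub, Matrix.sub_mul, Matrix.mul_sub, Matrix.mul_sub, hXW, hcross,
      hcross', hsq]
    abel
  rw [key]
  exact Matrix.posSemidef_self_mul_conjTranspose _

/-- A weighted sum of the projectors `v x (v x)ᴴ` in terms of the matrix with columns `v x`. -/
theorem Matrix.sum_smul_vecMulVec_star {m k : Type*} [Fintype k] [DecidableEq k]
    (v : k → m → ℂ) (c : k → ℂ) :
    ∑ x, c x • Matrix.vecMulVec (v x) (star (v x)) =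
      (Matrix.of v).transpose * Matrix.diagonal c * (Matrix.of v).transpose.conjTranspose := by
  ext i j
  rw [Matrix.mul_apply]
  simp only [Matrix.sum_apply, Matrix.smul_apply, Matrix.vecMulVec_apply,
    Matrix.mul_diagonal, Matrix.transpose_apply, Matrix.of_apply, Matrix.conjTranspose_apply,
    Pi.star_apply, smul_eq_mul]
  exact Finset.sum_congr rfl fun x _ => by ring

/-- The classical Fisher information of any local reverse estimation of a one-parameter
quantum state family is at least the RLD Fisher information `Tr(X ρ⁻¹ X)`. -/
theorem reverse_estimation_fisher_ge_rld {d n : ℕ}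
    (ρ X : Matrix (Fin d) (Fin d) ℂ) (hρ : ρ.PosDef) (hX : X.IsHermitian)
    (v : Fin n → (Fin d → ℂ)) (lam : Fin n → ℝ)
    (hρdec : ∑ x, Matrix.vecMulVec (v x) (star (v x)) = ρ)
    (hXdec : ∑ x, (lam x : ℂ) • Matrix.vecMulVec (v x) (star (v x)) = X) :
    (Matrix.trace (X * ρ⁻¹ * X)).re ≤ ∑ x, (lam x) ^ 2 * (∑ i, ‖v x i‖ ^ 2) := by
  set W := (Matrix.of v).transpose with hW
  set D : Matrix (Fin n) (Fin n) ℂ := Matrix.diagonal fun x => (lam x : ℂ) with hD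
  have hρW : W * W.conjTranspose = ρ := by
    have h := Matrix.sum_smul_vecMulVec_star v fun _ => 1
    simp only [one_smul, Matrix.diagonal_one, Matrix.mul_one] at h
    rw [← hρdec, h]
  have hXW : W * D * W.conjTranspose = X := by
    rw [← hXdec, Matrix.sum_smul_vecMulVec_star]
  have hDH : D.IsHermitian :=
    Matrix.isHermitian_diagonal_of_self_adjoint _ (by ext x; simp)
  have hpsd := Matrix.IsHermitian.posSemidef_mul_sq_mul_conjTranspose_sub W hDH
    (by rw [hρW]; exact (Matrix.isUnit_iff_isUnit_det _).1 hρ.isUnit)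
  rw [hρW, hXW] at hpsd
  have htr : (Matrix.trace (W * (D * D) * W.conjTranspose)).re =
      ∑ x, (lam x) ^ 2 * (∑ i, ‖v x i‖ ^ 2) := by
    rw [hD, Matrix.diagonal_mul_diagonal, ← Matrix.sum_smul_vecMulVec_star, Matrix.trace_sum,
      Complex.re_sum]
    refine Finset.sum_congr rfl fun x _ => ?_
    rw [Matrix.trace_smul, Matrix.trace_vecMulVec, smul_eq_mul, ← Complex.ofReal_mul,
      Complex.re_ofReal_mul, dotProduct, Complex.re_sum, sq]
    congr 1
    refine Finset.sum_congr rfl fun i _ => ?_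
    rw [Pi.star_apply, Complex.star_def, Complex.mul_conj, Complex.ofReal_re,
      Complex.normSq_eq_norm_sq]
  have h := (Complex.le_def.1 hpsd.trace_nonneg).1
  rw [Matrix.trace_sub, Complex.sub_re, htr, Complex.zero_re] at h
  linarith
end

section
/- Let ρ be a positive definite Hermitian d×d complex matrix and X a Hermitian d×d complex matrix. Then there exist vectors v₁,…,v_d in ℂ^d and real numbers λ₁,…,λ_d such that Σₓ vₓvₓ† = ρ, Σₓ λₓ vₓvₓ† = X, and Σₓ λₓ² ‖vₓ‖² = Tr(X ρ⁻¹ X). (That is, the RLD Fisher information is achieved by an optimal local reverse estimation with d' = rank ρ components.) -/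
open scoped ComplexOrder

/-- Simultaneous diagonalization by congruence of a positive definite matrix and a Hermitian
matrix. -/
theorem Matrix.PosDef.exists_isUnit_eq_mul_diagonal_mul_conjTranspose {n : Type*} [Fintype n]
    [DecidableEq n] {ρ X : Matrix n n ℂ} (hρ : ρ.PosDef) (hX : X.IsHermitian) :
    ∃ (V : Matrix n n ℂ) (lam : n → ℝ), IsUnit V ∧ V * V.conjTranspose = ρ ∧
      V * Matrix.diagonal (fun x => (lam x : ℂ)) * V.conjTranspose = X := by
  obtain ⟨A, hA, hAρ⟩ : ∃ A : Matrix n n ℂ, IsUnit A ∧ ρ = A * A.conjTranspose := by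
    obtain ⟨A, hA⟩ : ∃ A : Matrix n n ℂ, ρ = A.conjTranspose * A := by
      open scoped MatrixOrder in
      exact CStarAlgebra.nonneg_iff_eq_star_mul_self.mp hρ.posSemidef.nonneg
    refine ⟨A.conjTranspose, ?_, by simpa using hA⟩
    exact isUnit_of_mul_isUnit_left (hA ▸ hρ.isUnit)
  have hAdet := (Matrix.isUnit_iff_isUnit_det A).mp hA
  have hAHdet : IsUnit A.conjTranspose.det := by
    rw [Matrix.det_conjTranspose]; exact hAdet.star
  have hY : (A⁻¹ * X * A⁻¹.conjTranspose).IsHermitian :=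
    Matrix.isHermitian_mul_mul_conjTranspose _ hX
  obtain ⟨U, lam, hUU, hspec⟩ : ∃ (U : Matrix n n ℂ) (lam : n → ℝ), U * U.conjTranspose = 1 ∧
      U * Matrix.diagonal (fun x => (lam x : ℂ)) * U.conjTranspose =
        A⁻¹ * X * A⁻¹.conjTranspose :=
    ⟨hY.eigenvectorUnitary, hY.eigenvalues, Unitary.coe_mul_star_self _,
      hY.spectral_theorem.symm⟩
  refine ⟨A * U, lam, hA.mul (IsUnit.of_mul_eq_one _ hUU), ?_, ?_⟩
  · rw [Matrix.conjTranspose_mul, Matrix.mul_assoc, ← Matrix.mul_assoc _ _ A.conjTranspose, hUU,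
      Matrix.one_mul, hAρ]
  · calc _ = A * (A⁻¹ * X * A⁻¹.conjTranspose) * A.conjTranspose := by
          rw [← hspec]; simp only [Matrix.conjTranspose_mul, Matrix.mul_assoc]
      _ = X := by
          rw [Matrix.conjTranspose_nonsing_inv, Matrix.mul_assoc,
            Matrix.nonsing_inv_mul_cancel_right _ _ hAHdet,
            Matrix.mul_nonsing_inv_cancel_left _ _ hAdet]

/-- A congruence transform of a diagonal matrix as a combination of rank-one matrices. -/
theorem Matrix.sum_smul_vecMulVec_col {m n : Type*} [Fintype n] [DecidableEq n]
    (V : Matrix m n ℂ) (c : n → ℂ) :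
    ∑ x, c x • Matrix.vecMulVec (V.col x) (star (V.col x)) =
      V * Matrix.diagonal c * V.conjTranspose := by
  ext i j
  rw [Matrix.sum_apply, Matrix.mul_apply]
  refine Finset.sum_congr rfl fun x _ => ?_
  simp only [Matrix.smul_apply, Matrix.vecMulVec_apply, Matrix.mul_diagonal, Matrix.col_apply,
    Pi.star_apply, Matrix.conjTranspose_apply, smul_eq_mul]
  ring

/-- The RLD Fisher information `Tr(X ρ⁻¹ X)` is achieved by an optimal local reverse
estimation with `d' = rank ρ = d` components. -/
theorem exists_reverse_estimation_achieving_rld {d : ℕ}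
    (ρ X : Matrix (Fin d) (Fin d) ℂ) (hρ : ρ.PosDef) (hX : X.IsHermitian) :
    ∃ (v : Fin d → (Fin d → ℂ)) (lam : Fin d → ℝ),
      (∑ x, Matrix.vecMulVec (v x) (star (v x)) = ρ) ∧
      (∑ x, (lam x : ℂ) • Matrix.vecMulVec (v x) (star (v x)) = X) ∧
      ∑ x, (lam x) ^ 2 * (∑ i, ‖v x i‖ ^ 2) = (Matrix.trace (X * ρ⁻¹ * X)).re := by
  obtain ⟨V, lam, hV, rfl, rfl⟩ :=
    hρ.exists_isUnit_eq_mul_diagonal_mul_conjTranspose hX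
  refine ⟨V.col, lam, ?_, V.sum_smul_vecMulVec_col _, ?_⟩
  · simpa using V.sum_smul_vecMulVec_col 1
  have hVdet := (Matrix.isUnit_iff_isUnit_det V).mp hV
  have hVHdet : IsUnit V.conjTranspose.det := by
    rw [Matrix.det_conjTranspose]; exact hVdet.star
  set D := Matrix.diagonal (fun x => (lam x : ℂ)) with hD
  have hprod : V * D * V.conjTranspose * (V * V.conjTranspose)⁻¹ * (V * D * V.conjTranspose) =
      V * Matrix.diagonal (fun x => (lam x : ℂ) ^ 2) * V.conjTranspose := by
    rw [Matrix.mul_inv_rev, ← Matrix.mul_assoc _ _ V⁻¹,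
      Matrix.mul_nonsing_inv_cancel_right _ _ hVHdet, Matrix.mul_assoc V D V.conjTranspose,
      Matrix.mul_assoc _ V⁻¹, Matrix.nonsing_inv_mul_cancel_left _ _ hVdet, ← Matrix.mul_assoc,
      Matrix.mul_assoc V D D, hD, Matrix.diagonal_mul_diagonal]
    simp only [sq]
  rw [hprod, ← V.sum_smul_vecMulVec_col, Matrix.trace_sum, Complex.re_sum]
  refine Finset.sum_congr rfl fun x _ => ?_
  have hnorm : (V.col x) ⬝ᵥ star (V.col x) = ((∑ i, ‖V.col x i‖ ^ 2 : ℝ) : ℂ) := by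
    simp [dotProduct, Complex.mul_conj']
  rw [Matrix.trace_smul, Matrix.trace_vecMulVec, hnorm, smul_eq_mul]
  norm_cast
end

section
/- Let W be a d×d' complex matrix such that ρ := W W† is positive definite, and let A be a Hermitian d'×d' complex matrix. Set X := W A W†. Then Tr(X ρ⁻¹ X) ≤ Tr((W† W) A²), i.e. the RLD Fisher information Tr(ρ (L^R)† L^R) with L^R = X ρ⁻¹ is at most Tr(π̃(W) A A) with π̃(W) = W†W. Moreover, if the columns of W are linearly independent (equivalently W†W is invertible), equality holds. -/
open Matrix
open scoped ComplexOrder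

namespace Matrix

variable {m n : Type*} [Fintype m] [DecidableEq m] [Fintype n] [DecidableEq n]

/-- The orthogonal projection onto the row space of a matrix of full row rank is the identity
when the columns are linearly independent. -/
theorem conjTranspose_mul_inv_mul_eq_one (W : Matrix m n ℂ) (hW : IsUnit (W * Wᴴ))
    (hU : IsUnit (Wᴴ * W)) : Wᴴ * (W * Wᴴ)⁻¹ * W = 1 := by
  apply hU.mul_right_cancel
  calc Wᴴ * (W * Wᴴ)⁻¹ * W * (Wᴴ * W)
      = Wᴴ * ((W * Wᴴ)⁻¹ * (W * Wᴴ)) * W := by simp only [Matrix.mul_assoc]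
    _ = 1 * (Wᴴ * W) := by
      rw [nonsing_inv_mul _ ((isUnit_iff_isUnit_det _).mp hW), Matrix.mul_one, Matrix.one_mul]

/-- The gap between the ancilla term and the RLD Fisher information is a Gram trace. -/
theorem trace_ancilla_sub_trace_rld (W : Matrix m n ℂ) (A : Matrix n n ℂ)
    (hW : IsUnit (W * Wᴴ)) (hA : A.IsHermitian) :
    trace ((Wᴴ * W) * (A * A)) - trace ((W * A * Wᴴ) * (W * Wᴴ)⁻¹ * (W * A * Wᴴ))
      = trace ((W * A * (1 - Wᴴ * (W * Wᴴ)⁻¹ * W)) * (W * A * (1 - Wᴴ * (W * Wᴴ)⁻¹ * W))ᴴ) := by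
  set P := Wᴴ * (W * Wᴴ)⁻¹ * W with hP
  have hPH : Pᴴ = P := by
    simp only [hP, conjTranspose_mul, conjTranspose_nonsing_inv, conjTranspose_conjTranspose,
      Matrix.mul_assoc]
  have hPP : P * P = P := by
    calc P * P = Wᴴ * ((W * Wᴴ)⁻¹ * (W * Wᴴ)) * (W * Wᴴ)⁻¹ * W := by
          simp only [hP, Matrix.mul_assoc]
      _ = P := by
          rw [nonsing_inv_mul _ ((isUnit_iff_isUnit_det _).mp hW), Matrix.mul_one]
  have hQ : (1 - P) * (1 - P) = 1 - P := by
    rw [Matrix.mul_sub, Matrix.mul_one, Matrix.sub_mul, Matrix.one_mul, hPP, sub_self, sub_zero]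
  have hX : (W * A * Wᴴ) * (W * Wᴴ)⁻¹ * (W * A * Wᴴ) = W * A * P * (A * Wᴴ) := by
    simp only [hP, Matrix.mul_assoc]
  have hT : trace ((Wᴴ * W) * (A * A)) = trace (W * A * (A * Wᴴ)) := by
    rw [Matrix.mul_assoc, trace_mul_comm]
    simp only [Matrix.mul_assoc]
  have hB : (W * A * (1 - P)) * (W * A * (1 - P))ᴴ = W * A * (1 - P) * (A * Wᴴ) := by
    rw [conjTranspose_mul, conjTranspose_mul, hA.eq, conjTranspose_sub, conjTranspose_one, hPH,
      Matrix.mul_assoc (W * A), ← Matrix.mul_assoc (1 - P), hQ, ← Matrix.mul_assoc]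
  rw [hX, hT, hB, Matrix.mul_sub, Matrix.sub_mul, trace_sub, Matrix.mul_one]

end Matrix

/-- Duality between SLD and RLD: for a purification `W` of `ρ = W Wᴴ` and a Hermitian `A`
on the ancilla with `X = W A Wᴴ`, the RLD Fisher information `Tr(X ρ⁻¹ X)` is at most
`Tr((WᴴW) A²)`, with equality when the columns of `W` are linearly independent
(i.e. `WᴴW` is invertible). -/
theorem rld_le_ancilla_and_eq_of_isUnit {d d' : ℕ}
    (W : Matrix (Fin d) (Fin d') ℂ) (A : Matrix (Fin d') (Fin d') ℂ)
    (hρ : (W * Wᴴ).PosDef) (hA : A.IsHermitian) :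
    (Matrix.trace ((W * A * Wᴴ) * (W * Wᴴ)⁻¹ * (W * A * Wᴴ))).re
      ≤ (Matrix.trace ((Wᴴ * W) * (A * A))).re ∧
    (IsUnit (Wᴴ * W) →
      Matrix.trace ((W * A * Wᴴ) * (W * Wᴴ)⁻¹ * (W * A * Wᴴ))
        = Matrix.trace ((Wᴴ * W) * (A * A))) := by
  have hgap := trace_ancilla_sub_trace_rld W A hρ.isUnit hA
  refine ⟨?_, fun hU => ?_⟩
  · have h := (posSemidef_self_mul_conjTranspose
      (W * A * (1 - Wᴴ * (W * Wᴴ)⁻¹ * W))).trace_nonneg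
    rw [← hgap] at h
    exact (Complex.le_def.mp (sub_nonneg.mp h)).1
  · rw [conjTranspose_mul_inv_mul_eq_one W hρ.isUnit hU] at hgap
    simpa [sub_eq_zero, eq_comm] using hgap
end

section
/- Let ρ be a positive definite Hermitian d×d complex matrix and X a Hermitian d×d complex matrix. Let L^S be the unique Hermitian matrix with X = (L^S ρ + ρ L^S)/2. Then Tr(ρ (L^S)²) ≤ Tr(X ρ⁻¹ X), i.e. the SLD Fisher information is no larger than the RLD Fisher information. -/
open Matrix
open scoped ComplexOrder

/-- The gap between the RLD and SLD Fisher informations is a quarter of the trace of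
`K ρ⁻¹ Kᴴ`, where `K` is the commutator of `L` and `ρ`; here `ρ L - L ρ` stands for `Kᴴ`. -/
lemma trace_rld_eq_trace_sld_add {n : Type*} [Fintype n] [DecidableEq n]
    (ρ L : Matrix n n ℂ) (hρ : IsUnit ρ.det) :
    trace (((1 / 2 : ℂ) • (L * ρ + ρ * L)) * ρ⁻¹ * ((1 / 2 : ℂ) • (L * ρ + ρ * L))) =
      trace (ρ * (L * L)) +
        (1 / 4 : ℂ) * trace ((L * ρ - ρ * L) * ρ⁻¹ * (ρ * L - L * ρ)) := by
  have h₁ : (L * ρ + ρ * L) * ρ⁻¹ * (L * ρ + ρ * L) =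
      L * (L * ρ) + L * ρ * L + ρ * L * ρ⁻¹ * L * ρ + ρ * (L * L) := by
    simp only [add_mul, mul_add, mul_nonsing_inv_cancel_right _ _ hρ, Matrix.mul_assoc,
      nonsing_inv_mul_cancel_left _ _ hρ]
    abel
  have h₂ : (L * ρ - ρ * L) * ρ⁻¹ * (ρ * L - L * ρ) =
      L * ρ * L - L * (L * ρ) - ρ * (L * L) + ρ * L * ρ⁻¹ * L * ρ := by
    simp only [sub_mul, mul_sub, mul_nonsing_inv_cancel_right _ _ hρ, Matrix.mul_assoc,
      nonsing_inv_mul_cancel_left _ _ hρ]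
    abel
  have h₃ : trace (L * (L * ρ)) = trace (ρ * (L * L)) := by
    rw [← Matrix.mul_assoc, trace_mul_comm]
  have h₄ : trace (L * ρ * L) = trace (ρ * (L * L)) := by
    rw [Matrix.mul_assoc, trace_mul_comm, Matrix.mul_assoc]
  simp only [Matrix.smul_mul, Matrix.mul_smul, trace_smul, smul_eq_mul, h₁, h₂, trace_add,
    trace_sub, h₃, h₄]
  ring

/-- The SLD Fisher information `Tr(ρ (Lˢ)²)` is no larger than the RLD Fisher
information `Tr(X ρ⁻¹ X)`. -/
theorem sld_le_rld {d : ℕ} (ρ X L : Matrix (Fin d) (Fin d) ℂ)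
    (hρ : ρ.PosDef) (hX : X.IsHermitian)
    (hL : L.IsHermitian) (hXL : X = (1 / 2 : ℂ) • (L * ρ + ρ * L)) :
    (Matrix.trace (ρ * (L * L))).re ≤ (Matrix.trace (X * ρ⁻¹ * X)).re := by
  have hK : (L * ρ - ρ * L)ᴴ = ρ * L - L * ρ := by
    rw [conjTranspose_sub, conjTranspose_mul, conjTranspose_mul, hL.eq, hρ.isHermitian.eq]
  have h := (hρ.inv.posSemidef.mul_mul_conjTranspose_same (L * ρ - ρ * L)).trace_nonneg
  rw [hK] at h
  rw [hXL, trace_rld_eq_trace_sld_add ρ L ((isUnit_iff_isUnit_det ρ).mp hρ.isUnit)]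
  have hquarter : (0 : ℂ) ≤ 1 / 4 := by
    rw [Complex.le_def]
    norm_num
  have hgap := (Complex.le_def.mp (mul_nonneg hquarter h)).1
  rw [Complex.add_re]
  exact le_add_of_nonneg_right hgap
end

section
/- Let ρ be a positive definite Hermitian d×d complex matrix, X a Hermitian d×d complex matrix, and L^S the unique Hermitian matrix with X = (L^S ρ + ρ L^S)/2. Let {M_k}_{k∈K} be a finite POVM, i.e. each M_k is a positive semidefinite d×d matrix, each M_k ≠ 0, and Σ_k M_k = I. Then Σ_k (Re Tr(X M_k))² / Tr(ρ M_k) ≤ Tr(ρ (L^S)²). (The classical Fisher information of the measurement outcome distribution never exceeds the SLD Fisher information.) -/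
open Matrix
open scoped ComplexOrder

open scoped MatrixOrder Matrix.Norms.L2Operator in
/-- The trace of a product of two positive semidefinite matrices has nonnegative real part. -/
theorem Matrix.PosSemidef.re_trace_mul_nonneg {n : Type*} [Fintype n] [DecidableEq n]
    {A B : Matrix n n ℂ} (hA : A.PosSemidef) (hB : B.PosSemidef) :
    0 ≤ (Matrix.trace (A * B)).re := by
  obtain ⟨C, rfl⟩ := CStarAlgebra.nonneg_iff_eq_star_mul_self.mp hB.nonneg
  have h := (hA.mul_mul_conjTranspose_same C).trace_nonneg
  rw [← Matrix.mul_assoc, Matrix.trace_mul_comm, ← Matrix.mul_assoc]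
  exact (Complex.le_def.mp h).1

/-- The contribution of a single effect `M` to the classical Fisher information is bounded by
`Re Tr(L ρ L M)`. -/
theorem sq_re_trace_div_le {n : Type*} [Fintype n] [DecidableEq n] {ρ L M : Matrix n n ℂ}
    (hρ : ρ.PosSemidef) (hL : L.IsHermitian) (hM : M.PosSemidef) :
    (Matrix.trace (((1 / 2 : ℂ) • (L * ρ + ρ * L)) * M)).re ^ 2 / (Matrix.trace (ρ * M)).re
      ≤ (Matrix.trace (L * ρ * L * M)).re := by
  have key (t : ℝ) : 0 ≤ (Matrix.trace (L * ρ * L * M)).re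
      - 2 * t * (Matrix.trace (((1 / 2 : ℂ) • (L * ρ + ρ * L)) * M)).re
      + t ^ 2 * (Matrix.trace (ρ * M)).re := by
    have hH : (L - (t : ℂ) • (1 : Matrix n n ℂ))ᴴ = L - (t : ℂ) • (1 : Matrix n n ℂ) := by
      simp [Matrix.conjTranspose_sub, Matrix.conjTranspose_smul, hL.eq]
    have h := (hρ.mul_mul_conjTranspose_same (L - (t : ℂ) • (1 : Matrix n n ℂ))).re_trace_mul_nonneg
      hM
    rw [hH] at h
    convert h using 1
    simp [Matrix.sub_mul, Matrix.mul_sub, Matrix.add_mul, Matrix.trace_add, Matrix.trace_sub,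
      Matrix.trace_smul, Matrix.mul_assoc]
    ring
  by_cases hp : (Matrix.trace (ρ * M)).re = 0
  · simpa [hp] using key 0
  · have h := key ((Matrix.trace (((1 / 2 : ℂ) • (L * ρ + ρ * L)) * M)).re
      / (Matrix.trace (ρ * M)).re)
    generalize (Matrix.trace (((1 / 2 : ℂ) • (L * ρ + ρ * L)) * M)).re = x at h ⊢
    generalize (Matrix.trace (ρ * M)).re = p at h hp ⊢
    have e : 2 * (x / p) * x - (x / p) ^ 2 * p = x ^ 2 / p := by
      field_simp
      ring
    linarith

/-- The classical Fisher information of the outcome distribution of any finite POVM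
measurement never exceeds the SLD Fisher information `Tr(ρ (Lˢ)²)`. -/
theorem measurement_fisher_le_sld {d : ℕ} {K : Type*} [Fintype K]
    (ρ X L : Matrix (Fin d) (Fin d) ℂ)
    (hρ : ρ.PosDef) (hX : X.IsHermitian)
    (hL : L.IsHermitian) (hXL : X = (1 / 2 : ℂ) • (L * ρ + ρ * L))
    (M : K → Matrix (Fin d) (Fin d) ℂ)
    (hM : ∀ k, (M k).PosSemidef) (hM0 : ∀ k, M k ≠ 0) (hMsum : ∑ k, M k = 1) :
    ∑ k, (Matrix.trace (X * M k)).re ^ 2 / (Matrix.trace (ρ * M k)).re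
      ≤ (Matrix.trace (ρ * (L * L))).re := by
  subst hXL
  calc _ ≤ ∑ k, (Matrix.trace (L * ρ * L * M k)).re :=
        Finset.sum_le_sum fun k _ => sq_re_trace_div_le hρ.posSemidef hL (hM k)
    _ = (Matrix.trace (L * ρ * L)).re := by
        rw [← Complex.re_sum, ← Matrix.trace_sum, ← Matrix.mul_sum, hMsum, Matrix.mul_one]
    _ = (Matrix.trace (ρ * (L * L))).re := by
        rw [Matrix.mul_assoc, Matrix.trace_mul_comm, Matrix.mul_assoc]
end

section
/- Let ρ be a positive definite Hermitian d×d complex matrix and X a Hermitian d×d complex matrix. Let Λ(Y) = Σᵢ Kᵢ Y Kᵢ† be a completely positive trace-preserving map given by Kraus operators Kᵢ (d'×d complex matrices with Σᵢ Kᵢ† Kᵢ = I), and suppose Λ(ρ) is positive definite. Then Tr(Λ(X) Λ(ρ)⁻¹ Λ(X)) ≤ Tr(X ρ⁻¹ X). (The RLD Fisher information is monotone non-increasing under CPTP maps.) -/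
open Matrix
open scoped ComplexOrder

/-- Completing the square: the operator Schwarz inequality
`Λ(X) Λ(ρ)⁻¹ Λ(X) ≤ Λ(X ρ⁻¹ X)` for the completely positive map with Kraus operators `K i`. -/
theorem posSemidef_kraus_sub_kraus_mul_inv_mul {m n ι : Type*} [Fintype m] [Fintype n] [Fintype ι]
    [DecidableEq m] [DecidableEq n] {ρ X : Matrix n n ℂ} (hρ : ρ.PosDef) (hX : X.IsHermitian)
    (K : ι → Matrix m n ℂ) (hΛρ : (∑ i, K i * ρ * (K i)ᴴ).PosDef) :
    ((∑ i, K i * (X * ρ⁻¹ * X) * (K i)ᴴ) -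
      (∑ i, K i * X * (K i)ᴴ) * (∑ i, K i * ρ * (K i)ᴴ)⁻¹ *
        (∑ i, K i * X * (K i)ᴴ)).PosSemidef := by
  have hY : (∑ i, K i * X * (K i)ᴴ)ᴴ = ∑ i, K i * X * (K i)ᴴ := by
    simp [conjTranspose_sum, conjTranspose_mul, hX.eq, Matrix.mul_assoc]
  set S := ∑ i, K i * ρ * (K i)ᴴ with hS
  set Y := ∑ i, K i * X * (K i)ᴴ with hYdef
  have hSdet : IsUnit S.det := (isUnit_iff_isUnit_det _).1 hΛρ.isUnit
  have hρdet : IsUnit ρ.det := (isUnit_iff_isUnit_det _).1 hρ.isUnit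
  have key := posSemidef_sum Finset.univ fun i _ =>
    hρ.posSemidef.conjTranspose_mul_mul_same (ρ⁻¹ * X * (K i)ᴴ - (K i)ᴴ * (S⁻¹ * Y))
  convert key using 1
  have expand : ∀ i, (ρ⁻¹ * X * (K i)ᴴ - (K i)ᴴ * (S⁻¹ * Y))ᴴ * ρ *
        (ρ⁻¹ * X * (K i)ᴴ - (K i)ᴴ * (S⁻¹ * Y)) =
      K i * (X * ρ⁻¹ * X) * (K i)ᴴ - K i * X * (K i)ᴴ * (S⁻¹ * Y)
        - Y * S⁻¹ * (K i * X * (K i)ᴴ) + Y * S⁻¹ * (K i * ρ * (K i)ᴴ) * (S⁻¹ * Y) := by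
    intro i
    simp only [conjTranspose_sub, conjTranspose_mul, conjTranspose_conjTranspose,
      hρ.isHermitian.inv.eq, hΛρ.isHermitian.inv.eq, hX.eq, hY, Matrix.sub_mul, Matrix.mul_sub,
      Matrix.mul_assoc, mul_nonsing_inv_cancel_left _ _ hρdet,
      nonsing_inv_mul_cancel_left _ _ hρdet]
    abel
  simp only [expand, Finset.sum_add_distrib, Finset.sum_sub_distrib, ← Finset.mul_sum,
    ← Finset.sum_mul, ← hS, ← hYdef]
  simp only [Matrix.mul_assoc, mul_nonsing_inv_cancel_left _ _ hSdet]
  abel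

/-- A map in Kraus form with `∑ i, (K i)ᴴ * K i = 1` preserves the trace. -/
theorem trace_sum_kraus {m n ι R : Type*} [Fintype m] [Fintype n] [Fintype ι] [DecidableEq n]
    [CommRing R] [StarRing R] (K : ι → Matrix m n R) (hK : ∑ i, (K i)ᴴ * K i = 1)
    (A : Matrix n n R) : trace (∑ i, K i * A * (K i)ᴴ) = trace A := by
  have cycle : ∀ i, trace (K i * A * (K i)ᴴ) = trace ((K i)ᴴ * K i * A) :=
    fun i => trace_mul_cycle _ _ _
  rw [trace_sum, Finset.sum_congr rfl fun i _ => cycle i, ← trace_sum, ← Matrix.sum_mul, hK,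
    Matrix.one_mul]

/-- The RLD Fisher information `Tr(X ρ⁻¹ X)` is monotone non-increasing under
completely positive trace-preserving maps, given here in Kraus form
`Λ(Y) = ∑ i, Kᵢ Y Kᵢᴴ` with `∑ i, Kᵢᴴ Kᵢ = 1`. -/
theorem rld_monotone_cptp {d d' : ℕ} {ι : Type*} [Fintype ι]
    (ρ X : Matrix (Fin d) (Fin d) ℂ) (hρ : ρ.PosDef) (hX : X.IsHermitian)
    (K : ι → Matrix (Fin d') (Fin d) ℂ) (hK : ∑ i, (K i)ᴴ * K i = 1)
    (hΛρ : (∑ i, K i * ρ * (K i)ᴴ).PosDef) :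
    (Matrix.trace ((∑ i, K i * X * (K i)ᴴ) * (∑ i, K i * ρ * (K i)ᴴ)⁻¹ *
        (∑ i, K i * X * (K i)ᴴ))).re
      ≤ (Matrix.trace (X * ρ⁻¹ * X)).re := by
  have h := (posSemidef_kraus_sub_kraus_mul_inv_mul hρ hX K hΛρ).trace_nonneg
  rw [trace_sub, trace_sum_kraus K hK, sub_nonneg] at h
  exact (Complex.le_def.1 h).1
end

section
/- Let ρ be a positive definite Hermitian d×d complex matrix and X a Hermitian d×d complex matrix, and let L be the unique Hermitian matrix with X = (Lρ + ρL)/2. Let Λ(Y) = Σᵢ Kᵢ Y Kᵢ† be a completely positive trace-preserving map (Kraus operators Kᵢ with Σᵢ Kᵢ† Kᵢ = I) such that Λ(ρ) is positive definite, and let L' be the unique Hermitian matrix with Λ(X) = (L'Λ(ρ) + Λ(ρ)L')/2. Then Tr(Λ(ρ) (L')²) ≤ Tr(ρ L²). (The SLD Fisher information is monotone non-increasing under CPTP maps.) -/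
open Matrix
open scoped ComplexOrder

/-- Expansion of the trace of `(N K - K L) ρ (N K - K L)ᴴ` for Hermitian `L` and `N`. -/
lemma Matrix.trace_intertwiner_mul_mul_conjTranspose {m n : Type*} [Fintype m] [Fintype n]
    (ρ L : Matrix n n ℂ) (hL : L.IsHermitian) (N : Matrix m m ℂ) (hN : N.IsHermitian)
    (K : Matrix m n ℂ) :
    trace ((N * K - K * L) * ρ * (N * K - K * L)ᴴ)
      = trace (K * ρ * Kᴴ * (N * N)) + trace (Kᴴ * K * (L * ρ * L))
        - trace (K * (L * ρ + ρ * L) * Kᴴ * N) := by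
  have h₁ : trace (N * K * ρ * (Kᴴ * N)) = trace (K * ρ * Kᴴ * (N * N)) := by
    rw [← Matrix.mul_assoc (K * ρ * Kᴴ), trace_mul_comm _ N]
    simp only [Matrix.mul_assoc]
  have h₂ : trace (K * L * ρ * (L * Kᴴ)) = trace (Kᴴ * K * (L * ρ * L)) := by
    rw [← Matrix.mul_assoc, trace_mul_comm]
    simp only [Matrix.mul_assoc]
  have h₃ : trace (N * K * ρ * (L * Kᴴ)) = trace (K * (ρ * L) * Kᴴ * N) := by
    rw [trace_mul_comm (K * (ρ * L) * Kᴴ)]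
    simp only [Matrix.mul_assoc]
  have h₄ : trace (K * L * ρ * (Kᴴ * N)) = trace (K * (L * ρ) * Kᴴ * N) := by
    simp only [Matrix.mul_assoc]
  rw [conjTranspose_sub, conjTranspose_mul, conjTranspose_mul, hL.eq, hN.eq]
  simp only [Matrix.sub_mul, Matrix.mul_sub, Matrix.mul_add, Matrix.add_mul, trace_sub,
    trace_add, h₁, h₂, h₃, h₄]
  ring

/-- The SLD Fisher information `Tr(ρ L²)` is monotone non-increasing under
completely positive trace-preserving maps, given here in Kraus form
`Λ(Y) = ∑ i, Kᵢ Y Kᵢᴴ` with `∑ i, Kᵢᴴ Kᵢ = 1`. -/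
theorem sld_monotone_cptp {d d' : ℕ} {ι : Type*} [Fintype ι]
    (ρ X L : Matrix (Fin d) (Fin d) ℂ) (hρ : ρ.PosDef) (hX : X.IsHermitian)
    (hL : L.IsHermitian) (hXL : X = (1 / 2 : ℂ) • (L * ρ + ρ * L))
    (K : ι → Matrix (Fin d') (Fin d) ℂ) (hK : ∑ i, (K i)ᴴ * K i = 1)
    (hΛρ : (∑ i, K i * ρ * (K i)ᴴ).PosDef)
    (L' : Matrix (Fin d') (Fin d') ℂ) (hL' : L'.IsHermitian)
    (hXL' : ∑ i, K i * X * (K i)ᴴ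
      = (1 / 2 : ℂ) • (L' * (∑ i, K i * ρ * (K i)ᴴ) + (∑ i, K i * ρ * (K i)ᴴ) * L')) :
    (Matrix.trace ((∑ i, K i * ρ * (K i)ᴴ) * (L' * L'))).re
      ≤ (Matrix.trace (ρ * (L * L))).re := by
  have hnonneg : 0 ≤ ∑ i, trace ((L' * K i - K i * L) * ρ * (L' * K i - K i * L)ᴴ) :=
    Finset.sum_nonneg fun i _ => (hρ.posSemidef.mul_mul_conjTranspose_same _).trace_nonneg
  have hX₂ : L * ρ + ρ * L = (2 : ℂ) • X := by
    rw [hXL, smul_smul]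
    norm_num
  have hcross : ∑ i, trace (K i * (L * ρ + ρ * L) * (K i)ᴴ * L')
      = 2 * trace ((∑ i, K i * ρ * (K i)ᴴ) * (L' * L')) := by
    rw [← trace_sum, ← Finset.sum_mul, hX₂]
    simp only [Matrix.mul_smul, Matrix.smul_mul]
    rw [← Finset.smul_sum, hXL', smul_smul, Matrix.smul_mul, trace_smul, Matrix.add_mul,
      trace_add, Matrix.mul_assoc L', trace_mul_comm L', Matrix.mul_assoc, smul_eq_mul]
    ring
  have hinput : ∑ i, trace ((K i)ᴴ * K i * (L * ρ * L)) = trace (ρ * (L * L)) := by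
    rw [← trace_sum, ← Finset.sum_mul, hK, Matrix.one_mul, Matrix.mul_assoc, trace_mul_comm,
      Matrix.mul_assoc]
  have houtput : ∑ i, trace (K i * ρ * (K i)ᴴ * (L' * L'))
      = trace ((∑ i, K i * ρ * (K i)ᴴ) * (L' * L')) := by
    rw [← trace_sum, ← Finset.sum_mul]
  simp only [trace_intertwiner_mul_mul_conjTranspose ρ L hL L' hL', Finset.sum_sub_distrib,
    Finset.sum_add_distrib, hcross, hinput, houtput] at hnonneg
  have hre := (Complex.le_def.mp hnonneg).1
  simp only [Complex.zero_re, Complex.sub_re, Complex.add_re, Complex.mul_re, Complex.re_ofNat,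
    Complex.im_ofNat, zero_mul, sub_zero] at hre
  linarith
end

section
/- Let p be a probability vector on a finite set S with p(x) > 0 for all x, and let u : S → ℝ. Let T be a stochastic matrix from S to a finite set S' (T(y|x) ≥ 0 and Σ_y T(y|x) = 1 for each x), and suppose (Tp)(y) := Σ_x T(y|x)p(x) > 0 for all y ∈ S'. Then Σ_y (Σ_x T(y|x)u(x))² / (Tp)(y) ≤ Σ_x u(x)² / p(x). (Classical Fisher information is monotone non-increasing under stochastic maps.) -/
/-- Classical Fisher information is monotone non-increasing under stochastic maps. -/
theorem classical_fisher_monotone_stochastic {S S' : Type*} [Fintype S] [Fintype S']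
    (p : S → ℝ) (hp : ∀ x, 0 < p x) (hp1 : ∑ x, p x = 1)
    (u : S → ℝ)
    (T : S' → S → ℝ) (hT : ∀ y x, 0 ≤ T y x) (hT1 : ∀ x, ∑ y, T y x = 1)
    (hTp : ∀ y, 0 < ∑ x, T y x * p x) :
    ∑ y, (∑ x, T y x * u x) ^ 2 / (∑ x, T y x * p x)
      ≤ ∑ x, (u x) ^ 2 / p x := by
  calc ∑ y, (∑ x, T y x * u x) ^ 2 / (∑ x, T y x * p x)
      ≤ ∑ y, ∑ x, T y x * (u x ^ 2 / p x) := by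
        refine Finset.sum_le_sum fun y _ => ?_
        rw [div_le_iff₀ (hTp y)]
        refine Finset.sum_sq_le_sum_mul_sum_of_sq_le_mul _
          (fun x _ => mul_nonneg (hT y x) (div_nonneg (sq_nonneg _) (hp x).le))
          (fun x _ => mul_nonneg (hT y x) (hp x).le) fun x _ => le_of_eq ?_
        have hx := (hp x).ne'
        field_simp
    _ = ∑ x, u x ^ 2 / p x := by
        rw [Finset.sum_comm]
        simp_rw [← Finset.sum_mul, hT1, one_mul]
end

section
/- Let ρ and σ be positive definite Hermitian d×d complex matrices. Then Tr(ρ (log ρ − log σ)) ≤ Tr(ρ · log(ρ^{1/2} σ⁻¹ ρ^{1/2})), i.e. the relative entropy D(ρ||σ) is bounded above by the RLD divergence D^R(ρ||σ). -/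
open Matrix
open scoped ComplexOrder

/-- The logarithm of a matrix, via the continuous functional calculus
(for a positive definite Hermitian matrix this is the usual matrix logarithm). -/
noncomputable def matLog {n : Type*} [Fintype n] [DecidableEq n]
    (A : Matrix n n ℂ) : Matrix n n ℂ :=
  cfc Real.log A

/-- The positive square root of a matrix, via the continuous functional calculus
(for a positive semidefinite Hermitian matrix this is the usual positive square root). -/
noncomputable def matSqrt {n : Type*} [Fintype n] [DecidableEq n]
    (A : Matrix n n ℂ) : Matrix n n ℂ :=
  cfc Real.sqrt A

/-- If `∑ i, p i / (t i + s) ≤ ∑ j, w j / (r j + s)` for all `s > 0` and the weights have equal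
total mass, then integrating over `s` gives `∑ j, w j * log (r j) ≤ ∑ i, p i * log (t i)`. -/
theorem sum_mul_log_le_of_sum_div_add_le {ι κ : Type*} [Fintype ι] [Fintype κ]
    (p t : ι → ℝ) (w r : κ → ℝ) (ht : ∀ i, 0 < t i) (hr : ∀ j, 0 < r j)
    (hsum : ∑ i, p i = ∑ j, w j)
    (h : ∀ s : ℝ, 0 < s → ∑ i, p i / (t i + s) ≤ ∑ j, w j / (r j + s)) :
    ∑ j, w j * Real.log (r j) ≤ ∑ i, p i * Real.log (t i) := by
  set G : ℝ → ℝ := fun s => ∑ i, p i * Real.log (t i + s) - ∑ j, w j * Real.log (r j + s) with hG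
  have hderiv : ∀ s : ℝ, 0 ≤ s →
      HasDerivAt G (∑ i, p i / (t i + s) - ∑ j, w j / (r j + s)) s := by
    intro s hs
    have hlog : ∀ a c : ℝ, 0 < a →
        HasDerivAt (fun s => c * Real.log (a + s)) (c / (a + s)) s := by
      intro a c ha
      simpa [div_eq_mul_inv] using
        (((hasDerivAt_id s).const_add a).log (by simp only [id]; positivity)).const_mul c
    exact (HasDerivAt.fun_sum fun i _ => hlog (t i) (p i) (ht i)).sub
      (HasDerivAt.fun_sum fun j _ => hlog (r j) (w j) (hr j))
  have hanti : AntitoneOn G (Set.Ici 0) := by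
    refine antitoneOn_of_deriv_nonpos (convex_Ici 0)
      (fun s hs => (hderiv s hs).continuousAt.continuousWithinAt)
      (fun s hs => ?_) (fun s hs => ?_)
    · rw [interior_Ici] at hs
      exact (hderiv s (le_of_lt hs)).differentiableAt.differentiableWithinAt
    · rw [interior_Ici] at hs
      rw [(hderiv s (le_of_lt hs)).deriv]
      exact sub_nonpos.2 (h s hs)
  have hlim : Filter.Tendsto G Filter.atTop (nhds 0) := by
    have hlog : ∀ a c : ℝ, Filter.Tendsto (fun s => c * Real.log (a / s + 1))
        Filter.atTop (nhds 0) := by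
      intro a c
      have h1 : Filter.Tendsto (fun s : ℝ => a / s + 1) Filter.atTop (nhds 1) := by
        simpa using (Filter.Tendsto.const_div_atTop Filter.tendsto_id a).add_const 1
      simpa using (h1.log one_ne_zero).const_mul c
    have hlim' := (tendsto_finsetSum Finset.univ fun i _ => hlog (t i) (p i)).sub
      (tendsto_finsetSum Finset.univ fun j _ => hlog (r j) (w j))
    simp only [Finset.sum_const_zero, sub_zero] at hlim'
    refine hlim'.congr' ?_
    filter_upwards [Filter.eventually_gt_atTop 0] with s hs
    have hsplit : ∀ a : ℝ, 0 < a → Real.log (a / s + 1) = Real.log (a + s) - Real.log s := by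
      intro a ha
      rw [← Real.log_div (by positivity) hs.ne']
      congr 1
      field_simp
    simp only [hG, hsplit _ (ht _), hsplit _ (hr _), mul_sub, Finset.sum_sub_distrib,
      ← Finset.sum_mul, hsum]
    ring
  have h0 : 0 ≤ G 0 := by
    refine le_of_tendsto hlim ?_
    filter_upwards [Filter.eventually_ge_atTop 0] with s hs
    exact hanti Set.self_mem_Ici hs hs
  simpa [hG] using h0

section

variable {n : Type*} [Fintype n] [DecidableEq n]

/-- Unitary diagonalization of a positive definite matrix, compatible with the continuous
functional calculus. -/
theorem Matrix.PosDef.exists_cfc_eq_mul_diagonal_mul {A : Matrix n n ℂ} (hA : A.PosDef) :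
    ∃ (U : Matrix n n ℂ) (a : n → ℝ), U * Uᴴ = 1 ∧ Uᴴ * U = 1 ∧ (∀ i, 0 < a i) ∧
      A = U * diagonal (fun i => (a i : ℂ)) * Uᴴ ∧
      ∀ f : ℝ → ℝ, cfc f A = U * diagonal (fun i => (f (a i) : ℂ)) * Uᴴ := by
  refine ⟨hA.isHermitian.eigenvectorUnitary, hA.isHermitian.eigenvalues, ?_, ?_,
    hA.eigenvalues_pos, hA.isHermitian.spectral_theorem, fun f => ?_⟩
  · exact Unitary.mul_star_self_of_mem (SetLike.coe_mem _)
  · exact Unitary.star_mul_self_of_mem (SetLike.coe_mem _)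
  · rw [hA.isHermitian.cfc_eq, IsHermitian.cfc, Unitary.conjStarAlgAut_apply]
    rfl

theorem Matrix.trace_mul_conj_diagonal_re (B K : Matrix n n ℂ) (f : n → ℝ) :
    (trace (B * (K * diagonal (fun i => (f i : ℂ)) * Kᴴ))).re
      = ∑ k, ((Kᴴ * B * K) k k).re * f k := by
  have h : trace (B * (K * diagonal (fun i => (f i : ℂ)) * Kᴴ))
      = trace (Kᴴ * B * K * diagonal (fun i => (f i : ℂ))) := by
    rw [← Matrix.mul_assoc, trace_mul_comm]
    simp only [Matrix.mul_assoc]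
  rw [h]
  simp [trace, mul_diagonal]

theorem Matrix.sum_re_diag_conj_eq_trace_re {B K : Matrix n n ℂ} (hK : K * Kᴴ = 1) :
    ∑ k, ((Kᴴ * B * K) k k).re = (trace B).re := by
  have h := trace_mul_conj_diagonal_re B K fun _ => 1
  simp only [Complex.ofReal_one, diagonal_one, hK, mul_one] at h
  exact h.symm

theorem Matrix.trace_diagonal_mul_mul_diagonal_mul_conjTranspose_re
    (a b : n → ℝ) (x y : Matrix n n ℂ) :
    (trace (diagonal (fun j => (a j : ℂ)) * x * diagonal (fun i => (b i : ℂ)) * yᴴ)).re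
      = ∑ j, ∑ i, a j * b i * (x j i * star (y j i)).re := by
  simp only [trace, diag_apply, mul_apply (N := yᴴ), mul_diagonal, diagonal_mul,
    conjTranspose_apply, Complex.re_sum]
  refine Finset.sum_congr rfl fun j _ => Finset.sum_congr rfl fun i _ => ?_
  rw [show (a j : ℂ) * x j i * b i * star (y j i)
    = ((a j * b i : ℝ) : ℂ) * (x j i * star (y j i)) by push_cast; ring, Complex.re_ofReal_mul]

theorem two_mul_re_sub_le_normSq_div (x v : ℂ) {c : ℝ} (hc : 0 < c) :
    2 * (x * star v).re - c * (x * star x).re ≤ Complex.normSq v / c := by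
  rw [le_div_iff₀ hc]
  simp only [Complex.star_def, Complex.mul_re, Complex.conj_re, Complex.conj_im,
    Complex.normSq_apply]
  nlinarith [sq_nonneg (c * x.re - v.re), sq_nonneg (c * x.im - v.im)]

/-- The resolvent form of the comparison between the relative entropy and the RLD divergence:
`R` is the square root of `ρ`, `U`, `V` and `K` diagonalize `ρ`, `σ` and `R σ⁻¹ R`. -/
theorem sum_diag_div_le_sum_normSq_div {R U V K : Matrix n n ℂ} {l m t : n → ℝ}
    (hR : Rᴴ = R) (hU : U * Uᴴ = 1) (hV : V * Vᴴ = 1)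
    (hK' : Kᴴ * K = 1) (hl : ∀ i, 0 < l i) (hm : ∀ i, 0 < m i) (ht : ∀ i, 0 < t i)
    (hρ : R * R = U * diagonal (fun i => (l i : ℂ)) * Uᴴ)
    (hT : R * (V * diagonal (fun i => ((m i)⁻¹ : ℝ) : n → ℂ) * Vᴴ) * R
      = K * diagonal (fun i => (t i : ℂ)) * Kᴴ) {s : ℝ} (hs : 0 < s) :
    ∑ k, ((Kᴴ * (R * R) * K) k k).re / (t k + s)
      ≤ ∑ q : n × n, Complex.normSq ((Vᴴ * R * U) q.1 q.2) / (l q.2 / m q.1 + s) := by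
  set Y : Matrix n n ℂ := K * diagonal (fun i => ((t i + s)⁻¹ : ℝ) : n → ℂ) * Kᴴ with hY
  set S : Matrix n n ℂ := V * diagonal (fun i => ((m i)⁻¹ : ℝ) : n → ℂ) * Vᴴ with hS
  have hYH : Yᴴ = Y := by
    simp only [hY, conjTranspose_mul, diagonal_conjTranspose, conjTranspose_conjTranspose,
      Matrix.mul_assoc]
    congr 3
    ext i
    simp
  have hres : Y * (R * S * R) * Y + (s : ℂ) • (Y * Y) = Y := by
    have hc : ∀ a b : n → ℂ, (K * diagonal a * Kᴴ) * (K * diagonal b * Kᴴ)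
        = K * diagonal (fun i => a i * b i) * Kᴴ := by
      intro a b
      rw [← diagonal_mul_diagonal]
      calc _ = K * diagonal a * (Kᴴ * K) * diagonal b * Kᴴ := by simp only [Matrix.mul_assoc]
        _ = _ := by rw [hK']; simp only [Matrix.mul_assoc, Matrix.one_mul]
    rw [hT, hY, hc, hc, hc, ← Matrix.smul_mul, ← Matrix.mul_smul, ← diagonal_smul,
      ← Matrix.add_mul, ← Matrix.mul_add, diagonal_add]
    congr 3
    ext i
    have : (t i + s : ℂ) ≠ 0 := by exact_mod_cast (add_pos (ht i) hs).ne'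
    simp only [Pi.smul_apply, smul_eq_mul]
    push_cast
    field_simp
  set v : Matrix n n ℂ := Vᴴ * R * U with hv
  set x : Matrix n n ℂ := Vᴴ * R * Y * U with hx
  have hxH : xᴴ = Uᴴ * Y * R * V := by
    simp only [hx, conjTranspose_mul, hYH, hR, conjTranspose_conjTranspose, Matrix.mul_assoc]
  have hvH : vᴴ = Uᴴ * R * V := by
    simp only [hv, conjTranspose_mul, hR, conjTranspose_conjTranspose, Matrix.mul_assoc]
  have cancelU : ∀ B, U * (Uᴴ * B) = B := fun B => by
    rw [← Matrix.mul_assoc, hU, Matrix.one_mul]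
  have cancelV : ∀ B, V * (Vᴴ * B) = B := fun B => by
    rw [← Matrix.mul_assoc, hV, Matrix.one_mul]
  have h1 : trace (x * vᴴ) = trace (R * R * Y) := by
    rw [hvH, hx, trace_mul_comm, trace_mul_comm (R * R)]
    rw [show Uᴴ * R * V * (Vᴴ * R * Y * U) = Uᴴ * (R * R * Y * U) by
      simp only [Matrix.mul_assoc, cancelV], trace_mul_comm, Matrix.mul_assoc _ U, hU,
      Matrix.mul_one, trace_mul_comm]
  have h2 : trace (x * xᴴ) = trace (R * R * (Y * Y)) := by
    rw [hxH, hx, trace_mul_comm]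
    rw [show Uᴴ * Y * R * V * (Vᴴ * R * Y * U) = Uᴴ * (Y * (R * R * Y) * U) by
      simp only [Matrix.mul_assoc, cancelV], trace_mul_comm, Matrix.mul_assoc _ U, hU,
      Matrix.mul_one, trace_mul_comm, Matrix.mul_assoc (R * R)]
  have h3 : trace (diagonal (fun i => ((m i)⁻¹ : ℝ) : n → ℂ) * x
      * diagonal (fun i => (l i : ℂ)) * xᴴ) = trace (R * R * (Y * (R * S * R) * Y)) := by
    rw [hxH, hx]
    calc _ = trace (diagonal (fun i => ((m i)⁻¹ : ℝ) : n → ℂ) * (Vᴴ * R * Y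
          * (U * diagonal (fun i => (l i : ℂ)) * Uᴴ) * Y * R) * V) := by
          simp only [Matrix.mul_assoc]
      _ = trace (S * (R * Y * (R * R) * Y * R)) := by
          rw [← hρ, trace_mul_comm, hS]
          simp only [Matrix.mul_assoc]
      _ = trace ((S * R * Y) * (R * R * Y * R)) := by simp only [Matrix.mul_assoc]
      _ = _ := by
          rw [trace_mul_comm, Matrix.mul_assoc _ R (S * R * Y), Matrix.mul_assoc _ Y,
            Matrix.mul_assoc Y]
          simp only [Matrix.mul_assoc]
  have hmain : ∑ k, ((Kᴴ * (R * R) * K) k k).re / (t k + s)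
      = 2 * (trace (x * vᴴ)).re - s * (trace (x * xᴴ)).re
        - (trace (diagonal (fun i => ((m i)⁻¹ : ℝ) : n → ℂ) * x
          * diagonal (fun i => (l i : ℂ)) * xᴴ)).re := by
    have h4 : (trace (R * R * Y)).re = ∑ k, ((Kᴴ * (R * R) * K) k k).re / (t k + s) := by
      rw [hY, trace_mul_conj_diagonal_re]
      simp only [div_eq_mul_inv]
    have h5 : (trace (R * R * Y)).re = (trace (R * R * (Y * (R * S * R) * Y))).re
        + s * (trace (R * R * (Y * Y))).re := by
      conv_lhs => rw [← hres]
      rw [Matrix.mul_add, trace_add, Matrix.mul_smul, trace_smul, smul_eq_mul, Complex.add_re,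
        Complex.re_ofReal_mul]
    rw [h1, h2, h3, ← h4]
    linarith
  have hone : ∀ y : Matrix n n ℂ, (trace (x * yᴴ)).re = ∑ j, ∑ i, (x j i * star (y j i)).re := by
    intro y
    simpa using trace_diagonal_mul_mul_diagonal_mul_conjTranspose_re (fun _ => 1) (fun _ => 1) x y
  rw [hmain, hone, hone, trace_diagonal_mul_mul_diagonal_mul_conjTranspose_re,
    Fintype.sum_prod_type]
  simp only [Finset.mul_sum, ← Finset.sum_sub_distrib]
  refine Finset.sum_le_sum fun j _ => Finset.sum_le_sum fun i _ => ?_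
  refine le_trans (le_of_eq ?_) (two_mul_re_sub_le_normSq_div (x j i) (v j i)
    (add_pos (div_pos (hl i) (hm j)) hs))
  ring

end

/-- The quantum relative entropy `D(ρ‖σ) = Tr(ρ(log ρ − log σ))` is bounded above by
the RLD divergence `Dᴿ(ρ‖σ) = Tr(ρ log(ρ^{1/2} σ⁻¹ ρ^{1/2}))`. -/
theorem relativeEntropy_le_rldDivergence {d : ℕ}
    (ρ σ : Matrix (Fin d) (Fin d) ℂ) (hρ : ρ.PosDef) (hσ : σ.PosDef) :
    (Matrix.trace (ρ * (matLog ρ - matLog σ))).re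
      ≤ (Matrix.trace (ρ * matLog (matSqrt ρ * σ⁻¹ * matSqrt ρ))).re := by
  obtain ⟨U, l, hU, hU', hl, hρU, hUf⟩ := hρ.exists_cfc_eq_mul_diagonal_mul
  obtain ⟨V, m, hV, hV', hm, hσV, hVf⟩ := hσ.exists_cfc_eq_mul_diagonal_mul
  set R := matSqrt ρ with hRdef
  have hRH : Rᴴ = R := cfc_predicate (p := IsSelfAdjoint) Real.sqrt ρ
  have hRR : R * R = ρ := by
    rw [hRdef, matSqrt, hUf]
    calc _ = U * diagonal (fun i => (√(l i) : ℂ)) * (Uᴴ * U)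
          * diagonal (fun i => (√(l i) : ℂ)) * Uᴴ := by simp only [Matrix.mul_assoc]
      _ = U * (diagonal (fun i => (√(l i) : ℂ)) * diagonal (fun i => (√(l i) : ℂ))) * Uᴴ := by
          rw [hU']; simp only [Matrix.mul_assoc, Matrix.one_mul]
      _ = ρ := by
          rw [diagonal_mul_diagonal]
          simp only [← Complex.ofReal_mul, Real.mul_self_sqrt (hl _).le]
          exact hρU.symm
  have hσinv : σ⁻¹ = V * diagonal (fun i => ((m i)⁻¹ : ℝ) : Fin d → ℂ) * Vᴴ := by
    refine inv_eq_right_inv ?_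
    rw [hσV]
    calc _ = V * diagonal (fun i => (m i : ℂ)) * (Vᴴ * V)
          * diagonal (fun i => ((m i)⁻¹ : ℝ) : Fin d → ℂ) * Vᴴ := by simp only [Matrix.mul_assoc]
      _ = V * (diagonal (fun i => (m i : ℂ))
          * diagonal (fun i => ((m i)⁻¹ : ℝ) : Fin d → ℂ)) * Vᴴ := by
          rw [hV']; simp only [Matrix.mul_assoc, Matrix.one_mul]
      _ = 1 := by
          rw [diagonal_mul_diagonal]
          simp only [← Complex.ofReal_mul, mul_inv_cancel₀ (hm _).ne', Complex.ofReal_one,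
            diagonal_one, Matrix.mul_one, hV]
  have hRunit : IsUnit R := by
    have := hρ.isUnit
    rw [← hRR] at this
    exact isUnit_of_mul_isUnit_left this
  have hTpos : (R * σ⁻¹ * R).PosDef := by
    have h := (Matrix.IsUnit.posDef_star_left_conjugate_iff (x := σ⁻¹) hRunit).2 hσ.inv
    rwa [star_eq_conjTranspose, hRH] at h
  obtain ⟨K, t, hK, hK', ht, hTK, hKf⟩ := hTpos.exists_cfc_eq_mul_diagonal_mul
  set v := Vᴴ * R * U with hv
  have hvV : ∀ j, ((Vᴴ * ρ * V) j j).re = ∑ i, Complex.normSq (v j i) := by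
    intro j
    have : Vᴴ * ρ * V = v * vᴴ := by
      rw [← hRR, hv]
      simp only [conjTranspose_mul, conjTranspose_conjTranspose, hRH]
      calc _ = Vᴴ * R * 1 * (R * V) := by simp only [Matrix.mul_assoc, Matrix.one_mul]
        _ = _ := by rw [← hU]; simp only [Matrix.mul_assoc]
    rw [this, mul_apply, Complex.re_sum]
    simp [Complex.mul_conj]
  have hvU : ∀ i, ((Uᴴ * ρ * U) i i).re = ∑ j, Complex.normSq (v j i) := by
    intro i
    have : Uᴴ * ρ * U = vᴴ * v := by
      rw [← hRR, hv]
      simp only [conjTranspose_mul, conjTranspose_conjTranspose, hRH]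
      calc _ = Uᴴ * R * 1 * (R * U) := by simp only [Matrix.mul_assoc, Matrix.one_mul]
        _ = _ := by rw [← hV]; simp only [Matrix.mul_assoc]
    rw [this, mul_apply, Complex.re_sum]
    simp [← Complex.normSq_eq_conj_mul_self]
  have key := sum_mul_log_le_of_sum_div_add_le (fun k => ((Kᴴ * ρ * K) k k).re) t
    (fun q : Fin d × Fin d => Complex.normSq (v q.1 q.2)) (fun q => l q.2 / m q.1) ht
    (fun q => div_pos (hl _) (hm _))
    (by rw [sum_re_diag_conj_eq_trace_re hK, Fintype.sum_prod_type]
        simp only [← hvV]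
        rw [sum_re_diag_conj_eq_trace_re hV])
    (fun s hs => by
      have h := sum_diag_div_le_sum_normSq_div hRH hU hV hK' hl hm ht
        (hRR.trans hρU) (by rw [← hσinv]; exact hTK) hs
      rwa [hRR] at h)
  have hL : (trace (ρ * (matLog ρ - matLog σ))).re
      = ∑ q : Fin d × Fin d, Complex.normSq (v q.1 q.2) * Real.log (l q.2 / m q.1) := by
    rw [Matrix.mul_sub, trace_sub, Complex.sub_re, matLog, matLog, hUf, hVf,
      trace_mul_conj_diagonal_re, trace_mul_conj_diagonal_re, Fintype.sum_prod_type]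
    simp only [hvV, hvU, Real.log_div (hl _).ne' (hm _).ne', mul_sub, Finset.sum_sub_distrib,
      Finset.sum_mul]
    rw [Finset.sum_comm]
  rw [hL, matLog, hKf, trace_mul_conj_diagonal_re]
  exact key
end

section
/- Let p and q be probability vectors on a finite set S with p(x) > 0 and q(x) > 0 for all x, and for s ∈ [0,1] set p_s(x) = s·p(x) + (1−s)·q(x). Then Σ_x p(x)·log(p(x)/q(x)) = ∫₀¹ ∫₀ᵗ (Σ_x (p(x)−q(x))²/p_s(x)) ds dt. (The Kullback–Leibler divergence equals the double integral of the classical Fisher information along the mixture curve.) -/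
lemma mixture_pos {a b s : ℝ} (ha : 0 < a) (hb : 0 < b) (hs : s ∈ Set.Icc (0 : ℝ) 1) :
    0 < s * a + (1 - s) * b := by
  obtain ⟨h0, h1⟩ := hs
  rcases h0.eq_or_lt with rfl | h0
  · simpa using hb
  · have := mul_pos h0 ha
    have := mul_nonneg (sub_nonneg.2 h1) hb.le
    linarith

lemma hasDerivAt_mixture (a b s : ℝ) :
    HasDerivAt (fun s : ℝ => s * a + (1 - s) * b) (a - b) s := by
  have h := ((hasDerivAt_id s).mul_const a).add
    (((hasDerivAt_id s).const_sub 1).mul_const b)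
  refine h.congr_deriv ?_
  ring

lemma continuousOn_fisher_term {a b : ℝ} (ha : 0 < a) (hb : 0 < b) :
    ContinuousOn (fun s : ℝ => (a - b) ^ 2 / (s * a + (1 - s) * b)) (Set.Icc 0 1) :=
  ContinuousOn.div (by fun_prop) (by fun_prop) fun _ hs => (mixture_pos ha hb hs).ne'

lemma continuousOn_log_mixture {a b : ℝ} (ha : 0 < a) (hb : 0 < b) :
    ContinuousOn (fun s : ℝ => (a - b) * (Real.log (s * a + (1 - s) * b) - Real.log b))
      (Set.Icc 0 1) := by
  refine continuousOn_const.mul (ContinuousOn.sub ?_ continuousOn_const)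
  exact ContinuousOn.log (by fun_prop) fun _ hs => (mixture_pos ha hb hs).ne'

lemma integral_fisher_term {a b t : ℝ} (ha : 0 < a) (hb : 0 < b)
    (ht : t ∈ Set.Icc (0 : ℝ) 1) :
    ∫ s in (0 : ℝ)..t, (a - b) ^ 2 / (s * a + (1 - s) * b)
      = (a - b) * (Real.log (t * a + (1 - t) * b) - Real.log b) := by
  have hsub : Set.uIcc 0 t ⊆ Set.Icc (0 : ℝ) 1 := by
    rw [Set.uIcc_of_le ht.1]
    exact Set.Icc_subset_Icc_right ht.2
  rw [intervalIntegral.integral_eq_sub_of_hasDerivAt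
    (f := fun s : ℝ => (a - b) * Real.log (s * a + (1 - s) * b))]
  · simp [mul_sub]
  · intro s hs
    refine (((hasDerivAt_mixture a b s).log
      (mixture_pos ha hb (hsub hs)).ne').const_mul (a - b)).congr_deriv ?_
    ring
  · exact ((continuousOn_fisher_term ha hb).mono hsub).intervalIntegrable

lemma integral_log_mixture {a b : ℝ} (ha : 0 < a) (hb : 0 < b) :
    ∫ t in (0 : ℝ)..1, (a - b) * (Real.log (t * a + (1 - t) * b) - Real.log b)
      = a * Real.log (a / b) - (a - b) := by
  have hsub : Set.uIcc (0 : ℝ) 1 = Set.Icc 0 1 := Set.uIcc_of_le zero_le_one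
  rw [intervalIntegral.integral_eq_sub_of_hasDerivAt
    (f := fun t : ℝ => (t * a + (1 - t) * b) * Real.log (t * a + (1 - t) * b)
      - (t * a + (1 - t) * b) * (1 + Real.log b))]
  · rw [Real.log_div ha.ne' hb.ne']
    simp
    ring
  · intro t ht
    have hne := (mixture_pos ha hb (hsub ▸ ht)).ne'
    have hm := hasDerivAt_mixture a b t
    refine ((hm.mul (hm.log hne)).sub (hm.mul_const (1 + Real.log b))).congr_deriv ?_
    rw [mul_div_cancel₀ _ hne]
    ring
  · exact (hsub ▸ continuousOn_log_mixture ha hb).intervalIntegrable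

/-- The Kullback–Leibler divergence equals the double integral of the classical Fisher
information along the mixture curve `p_s = s·p + (1−s)·q`. -/
theorem kl_eq_double_integral_fisher {S : Type*} [Fintype S]
    (p q : S → ℝ) (hp : ∀ x, 0 < p x) (hq : ∀ x, 0 < q x)
    (hp1 : ∑ x, p x = 1) (hq1 : ∑ x, q x = 1) :
    ∑ x, p x * Real.log (p x / q x)
      = ∫ t in (0 : ℝ)..1, ∫ s in (0 : ℝ)..t,
          ∑ x, (p x - q x) ^ 2 / (s * p x + (1 - s) * q x) := by
  have hIcc : Set.uIcc (0 : ℝ) 1 = Set.Icc 0 1 := Set.uIcc_of_le zero_le_one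
  have hinner : Set.EqOn
      (fun t : ℝ => ∫ s in (0 : ℝ)..t, ∑ x, (p x - q x) ^ 2 / (s * p x + (1 - s) * q x))
      (fun t => ∑ x, (p x - q x) * (Real.log (t * p x + (1 - t) * q x) - Real.log (q x)))
      (Set.uIcc 0 1) := by
    intro t ht
    rw [hIcc] at ht
    have hsub : Set.uIcc 0 t ⊆ Set.Icc (0 : ℝ) 1 := by
      rw [Set.uIcc_of_le ht.1]
      exact Set.Icc_subset_Icc_right ht.2
    dsimp only
    rw [intervalIntegral.integral_finsetSum fun x _ =>
      ((continuousOn_fisher_term (hp x) (hq x)).mono hsub).intervalIntegrable]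
    exact Finset.sum_congr rfl fun x _ => integral_fisher_term (hp x) (hq x) ht
  rw [intervalIntegral.integral_congr hinner,
    intervalIntegral.integral_finsetSum fun x _ =>
      (hIcc ▸ continuousOn_log_mixture (hp x) (hq x)).intervalIntegrable]
  simp only [integral_log_mixture (hp _) (hq _), Finset.sum_sub_distrib, hp1, hq1, sub_self,
    sub_zero]
end

section
/- Let ρ and σ be positive definite Hermitian d×d complex matrices. Then there exist vectors w₁,…,w_d in ℂ^d and positive reals λ₁,…,λ_d such that Σₓ wₓwₓ† = σ, Σₓ λₓ wₓwₓ† = ρ, and Σₓ λₓ‖wₓ‖² · log λₓ = Tr(ρ · log(ρ^{1/2} σ⁻¹ ρ^{1/2})). (There exists a reverse estimation of (ρ, σ) whose classical divergence equals the RLD divergence D^R(ρ||σ): with qₓ = ‖wₓ‖² and pₓ = λₓ‖wₓ‖², the Kullback–Leibler divergence Σₓ pₓ log(pₓ/qₓ) equals D^R(ρ||σ).) -/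
open Matrix
open scoped ComplexOrder

namespace Matrix

variable {n : Type*}

/-- Functional calculus of a Hermitian matrix as a sum over an orthonormal eigenbasis. -/
lemma IsHermitian.cfc_eq_sum_vecMulVec [Fintype n] [DecidableEq n] {A : Matrix n n ℂ}
    (hA : A.IsHermitian) (f : ℝ → ℝ) :
    _root_.cfc f A = ∑ x, (f (hA.eigenvalues x) : ℂ) •
      vecMulVec (hA.eigenvectorBasis x).ofLp (star (hA.eigenvectorBasis x).ofLp) := by
  rw [hA.cfc_eq, IsHermitian.cfc, Unitary.conjStarAlgAut_apply]
  ext i j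
  rw [mul_apply]
  simp only [mul_diagonal, star_eq_conjTranspose, conjTranspose_apply, sum_apply,
    smul_apply, vecMulVec_apply, hA.eigenvectorUnitary_apply, Pi.star_apply, smul_eq_mul,
    Function.comp_apply]
  refine Finset.sum_congr rfl fun x _ => ?_
  simp only [Complex.coe_algebraMap, RCLike.star_def]
  ring

lemma mul_vecMulVec_star_mul_conjTranspose [Fintype n] (S : Matrix n n ℂ) (v : n → ℂ) :
    S * vecMulVec v (star v) * Sᴴ = vecMulVec (S *ᵥ v) (star (S *ᵥ v)) := by
  rw [mul_vecMulVec, vecMulVec_mul, star_mulVec]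

lemma vecMulVec_ofReal_smul_star (c : ℝ) (v : n → ℂ) :
    vecMulVec ((c : ℂ) • v) (star ((c : ℂ) • v)) = ((c ^ 2 : ℝ) : ℂ) • vecMulVec v (star v) := by
  ext i j
  simp [vecMulVec_apply]
  ring

lemma trace_vecMulVec_star [Fintype n] (v : n → ℂ) :
    (vecMulVec v (star v)).trace = ((∑ i, ‖v i‖ ^ 2 : ℝ) : ℂ) := by
  simp [trace, vecMulVec_apply, Complex.mul_conj']

lemma cfc_inv_eq_inv [Fintype n] [DecidableEq n] {A : Matrix n n ℂ} (hA : A.PosDef) :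
    cfc (fun t : ℝ => t⁻¹) A = A⁻¹ := by
  have hsa : IsSelfAdjoint A := hA.isHermitian
  have hpos : ∀ t ∈ spectrum ℝ A, t ≠ 0 := by
    intro t ht
    rw [hA.isHermitian.spectrum_real_eq_range_eigenvalues] at ht
    obtain ⟨i, rfl⟩ := ht
    exact (hA.eigenvalues_pos i).ne'
  refine (inv_eq_left_inv ?_).symm
  nth_rewrite 2 [← cfc_id ℝ A]
  rw [← cfc_mul (fun t : ℝ => t⁻¹) id A (continuousOn_id.inv₀ hpos) continuousOn_id, ← cfc_one ℝ A]
  exact cfc_congr fun t ht => inv_mul_cancel₀ (hpos t ht)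

end Matrix

section matSqrt

variable {n : Type*} [Fintype n] [DecidableEq n]

lemma matSqrt_isHermitian (A : Matrix n n ℂ) : (matSqrt A).IsHermitian :=
  cfc_predicate (p := IsSelfAdjoint) Real.sqrt A

lemma matSqrt_mul_self {A : Matrix n n ℂ} (hA : A.PosSemidef) : matSqrt A * matSqrt A = A := by
  have hsa : IsSelfAdjoint A := hA.isHermitian
  rw [matSqrt, ← cfc_mul ..]
  conv_rhs => rw [← cfc_id ℝ A]
  refine cfc_congr fun t ht => ?_
  rw [hA.isHermitian.spectrum_real_eq_range_eigenvalues] at ht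
  obtain ⟨i, rfl⟩ := ht
  exact Real.mul_self_sqrt (hA.eigenvalues_nonneg i)

lemma isUnit_matSqrt {A : Matrix n n ℂ} (hA : A.PosDef) : IsUnit (matSqrt A) := by
  refine isUnit_of_mul_isUnit_left (y := matSqrt A) ?_
  rw [matSqrt_mul_self hA.posSemidef]
  exact hA.isUnit

end matSqrt

/-- There exists a reverse estimation of `(ρ, σ)` whose classical divergence equals the
RLD divergence `Dᴿ(ρ‖σ)`: with `qₓ = ‖wₓ‖²` and `pₓ = λₓ‖wₓ‖²`, the Kullback–Leibler
divergence `∑ₓ pₓ log(pₓ/qₓ) = ∑ₓ λₓ‖wₓ‖² log λₓ` equals `Dᴿ(ρ‖σ)`. -/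
theorem exists_reverse_estimation_achieving_rldDivergence {d : ℕ}
    (ρ σ : Matrix (Fin d) (Fin d) ℂ) (hρ : ρ.PosDef) (hσ : σ.PosDef) :
    ∃ (w : Fin d → (Fin d → ℂ)) (lam : Fin d → ℝ),
      (∀ x, 0 < lam x) ∧
      (∑ x, Matrix.vecMulVec (w x) (star (w x)) = σ) ∧
      (∑ x, (lam x : ℂ) • Matrix.vecMulVec (w x) (star (w x)) = ρ) ∧
      ∑ x, lam x * (∑ i, ‖w x i‖ ^ 2) * Real.log (lam x)
        = (Matrix.trace (ρ * matLog (matSqrt ρ * σ⁻¹ * matSqrt ρ))).re := by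
  set S := matSqrt ρ
  have hSh : Sᴴ = S := matSqrt_isHermitian ρ
  have hSS : S * S = ρ := matSqrt_mul_self hρ.posSemidef
  have hSu : IsUnit S := isUnit_matSqrt hρ
  have hSdet : IsUnit S.det := (Matrix.isUnit_iff_isUnit_det S).mp hSu
  have hM : (S * σ⁻¹ * S).PosDef := by
    have h := hσ.inv.conjTranspose_mul_mul_same (Matrix.mulVec_injective_of_isUnit hSu)
    rwa [hSh] at h
  set M := S * σ⁻¹ * S with hMdef
  set lam := hM.isHermitian.eigenvalues
  have hpos : ∀ x, 0 < lam x := hM.eigenvalues_pos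
  let v : Fin d → Fin d → ℂ := fun x => S *ᵥ (hM.isHermitian.eigenvectorBasis x).ofLp
  have key (f : ℝ → ℝ) :
      S * cfc f M * S = ∑ x, (f (lam x) : ℂ) • vecMulVec (v x) (star (v x)) := by
    rw [hM.isHermitian.cfc_eq_sum_vecMulVec, Finset.mul_sum, Finset.sum_mul]
    refine Finset.sum_congr rfl fun x _ => ?_
    have h := mul_vecMulVec_star_mul_conjTranspose S (hM.isHermitian.eigenvectorBasis x).ofLp
    rw [hSh] at h
    rw [Matrix.mul_smul, Matrix.smul_mul, h]
  have hw (x : Fin d) :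
      vecMulVec ((((√(lam x))⁻¹ : ℝ) : ℂ) • v x) (star ((((√(lam x))⁻¹ : ℝ) : ℂ) • v x))
        = (((lam x)⁻¹ : ℝ) : ℂ) • vecMulVec (v x) (star (v x)) := by
    rw [vecMulVec_ofReal_smul_star, inv_pow, Real.sq_sqrt (hpos x).le]
  have hcancel (x : Fin d) : (lam x : ℂ) * (((lam x)⁻¹ : ℝ) : ℂ) = 1 := by
    rw [← Complex.ofReal_mul, mul_inv_cancel₀ (hpos x).ne', Complex.ofReal_one]
  refine ⟨fun x => (((√(lam x))⁻¹ : ℝ) : ℂ) • v x, lam, hpos, ?_, ?_, ?_⟩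
  · simp only [hw]
    rw [← key fun t => t⁻¹, cfc_inv_eq_inv hM, hMdef, Matrix.mul_inv_rev, Matrix.mul_inv_rev,
      Matrix.nonsing_inv_nonsing_inv _ ((Matrix.isUnit_iff_isUnit_det σ).mp hσ.isUnit),
      Matrix.mul_nonsing_inv_cancel_left _ _ hSdet, Matrix.nonsing_inv_mul_cancel_right _ _ hSdet]
  · simp only [hw, smul_smul, hcancel]
    have h := key fun _ => 1
    rw [cfc_const_one ℝ M hM.isHermitian.isSelfAdjoint, mul_one, hSS] at h
    simpa using h.symm
  · have hterm (x : Fin d) : ∑ i, ‖((((√(lam x))⁻¹ : ℝ) : ℂ) • v x) i‖ ^ 2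
        = (lam x)⁻¹ * ∑ i, ‖v x i‖ ^ 2 := by
      have h := congrArg trace (hw x)
      rw [trace_smul, trace_vecMulVec_star, trace_vecMulVec_star, smul_eq_mul] at h
      exact_mod_cast h
    have htr : trace (ρ * matLog M) = ∑ x, ((Real.log (lam x) * ∑ i, ‖v x i‖ ^ 2 : ℝ) : ℂ) := by
      rw [← hSS, mul_assoc, trace_mul_comm, matLog, key, trace_sum]
      refine Finset.sum_congr rfl fun x _ => ?_
      rw [trace_smul, trace_vecMulVec_star, smul_eq_mul, Complex.ofReal_mul]
    rw [htr, ← Complex.ofReal_sum, Complex.ofReal_re]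
    refine Finset.sum_congr rfl fun x _ => ?_
    rw [hterm, mul_inv_cancel_left₀ (hpos x).ne', mul_comm]
end

section
/- Let W be an invertible d×d complex matrix, set ρ = W W† (positive definite), and let X be a Hermitian d×d complex matrix. Define A = W⁻¹ X (W†)⁻¹. Then: (1) A is Hermitian; (2) (X ρ⁻¹) W = W A, i.e. A is the reverse SLD: L^R W = W A where L^R = X ρ⁻¹ is the right logarithmic derivative; (3) setting Ẇ = (1/2) X ρ⁻¹ W, we have Ẇ† W + W† Ẇ = (1/2)(A (W†W) + (W†W) A), i.e. A is the SLD of the ancilla family π̃(W) = W†W; and (4) Tr(X ρ⁻¹ X) = Tr((W†W) A²), i.e. the RLD Fisher information of the system equals the SLD Fisher information of the ancilla. -/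
open Matrix
open scoped ComplexOrder

/-- Duality between SLD and RLD via purification: for invertible `W`, `ρ = W Wᴴ` and
Hermitian `X`, the matrix `A = W⁻¹ X (Wᴴ)⁻¹` is Hermitian, is the reverse SLD
(`Lᴿ W = W A` with `Lᴿ = X ρ⁻¹`), is the SLD of the ancilla family `π̃(W) = WᴴW`
(with lift `Ẇ = (1/2) Lᴿ W`), and the RLD Fisher information of the system equals
the SLD Fisher information of the ancilla. -/
theorem sld_rld_duality {d : ℕ}
    (W X : Matrix (Fin d) (Fin d) ℂ) (hW : IsUnit W) (hX : X.IsHermitian) :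
    (W⁻¹ * X * (Wᴴ)⁻¹).IsHermitian ∧
    (X * (W * Wᴴ)⁻¹) * W = W * (W⁻¹ * X * (Wᴴ)⁻¹) ∧
    ((1 / 2 : ℂ) • (X * (W * Wᴴ)⁻¹ * W))ᴴ * W + Wᴴ * ((1 / 2 : ℂ) • (X * (W * Wᴴ)⁻¹ * W))
      = (1 / 2 : ℂ) • ((W⁻¹ * X * (Wᴴ)⁻¹) * (Wᴴ * W) + (Wᴴ * W) * (W⁻¹ * X * (Wᴴ)⁻¹)) ∧
    Matrix.trace (X * (W * Wᴴ)⁻¹ * X)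
      = Matrix.trace ((Wᴴ * W) * ((W⁻¹ * X * (Wᴴ)⁻¹) * (W⁻¹ * X * (Wᴴ)⁻¹))) := by
  have hdet : IsUnit W.det := (Matrix.isUnit_iff_isUnit_det W).mp hW
  have hdet' : IsUnit (Wᴴ).det := by
    rw [Matrix.det_conjTranspose]
    exact hdet.star
  have hA : (W⁻¹ * X * (Wᴴ)⁻¹).IsHermitian := by
    rw [← Matrix.conjTranspose_nonsing_inv]
    exact Matrix.isHermitian_mul_mul_conjTranspose W⁻¹ hX
  have hR : (X * (W * Wᴴ)⁻¹) * W = W * (W⁻¹ * X * (Wᴴ)⁻¹) := by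
    rw [Matrix.mul_inv_rev, ← Matrix.mul_assoc X, Matrix.nonsing_inv_mul_cancel_right _ _ hdet,
      Matrix.mul_assoc W⁻¹, Matrix.mul_nonsing_inv_cancel_left _ _ hdet]
  have hX' : W * (W⁻¹ * X * (Wᴴ)⁻¹) * Wᴴ = X := by
    rw [Matrix.mul_assoc W⁻¹, Matrix.mul_nonsing_inv_cancel_left _ _ hdet,
      Matrix.nonsing_inv_mul_cancel_right _ _ hdet']
  refine ⟨hA, hR, ?_, ?_⟩
  · rw [hR, Matrix.conjTranspose_smul, Matrix.conjTranspose_mul, hA.eq]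
    have h : star (1 / 2 : ℂ) = 1 / 2 := by simp
    rw [h, Matrix.smul_mul, Matrix.mul_smul, ← smul_add, Matrix.mul_assoc, Matrix.mul_assoc Wᴴ W]
  · generalize W⁻¹ * X * (Wᴴ)⁻¹ = A at hR hX'
    calc Matrix.trace (X * (W * Wᴴ)⁻¹ * X)
        = Matrix.trace (X * (W * Wᴴ)⁻¹ * (W * A * Wᴴ)) := by rw [hX']
      _ = Matrix.trace (X * (W * Wᴴ)⁻¹ * W * (A * Wᴴ)) := by simp only [Matrix.mul_assoc]
      _ = Matrix.trace (W * A * A * Wᴴ) := by rw [hR]; simp only [Matrix.mul_assoc]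
      _ = Matrix.trace ((Wᴴ * W) * (A * A)) := by
        rw [Matrix.trace_mul_comm]; simp only [Matrix.mul_assoc]
end

section
/- Let W be an invertible d×d complex matrix and let θ ↦ M_θ be a differentiable family of Hermitian positive definite d×d complex matrices parameterized by θ ∈ ℝ^m, such that M_{θ₁} M_{θ₂} = M_{θ₂} M_{θ₁} for all θ₁, θ₂ ∈ ℝ^m. Define ρ_θ = W M_θ W† and let L^R_{θ,i} = (∂_i ρ_θ) ρ_θ⁻¹ be the right logarithmic derivatives. Then L^R_{θ,i} L^R_{θ',j} = L^R_{θ',j} L^R_{θ,i} for all i, j ∈ {1,…,m} and all θ, θ' ∈ ℝ^m. (Condition (ii) of the theorem on global reverse estimation implies condition (iii): commutativity of the matrices M_θ implies commutativity of all RLDs of the family.) -/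
open Matrix
open scoped ComplexOrder

theorem Matrix.hasDerivAt_mul_mul_apply {n : Type*} [Fintype n]
    {F : ℝ → Matrix n n ℂ} {F' : Matrix n n ℂ} {t : ℝ}
    (hF : ∀ a b, HasDerivAt (fun s => F s a b) (F' a b) t) (A B : Matrix n n ℂ) (a b : n) :
    HasDerivAt (fun s => (A * F s * B) a b) ((A * F' * B) a b) t := by
  simp only [Matrix.mul_apply]
  exact HasDerivAt.fun_sum fun k _ =>
    (HasDerivAt.fun_sum fun l _ => (hF l k).const_mul (A a l)).mul_const (B k b)

/-- A matrix commuting with every value of a curve commutes with its entrywise derivative. -/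
theorem Matrix.commute_of_hasDerivAt {n : Type*} [Fintype n] [DecidableEq n]
    {F : ℝ → Matrix n n ℂ} {F' : Matrix n n ℂ} {t : ℝ}
    (hF : ∀ a b, HasDerivAt (fun s => F s a b) (F' a b) t) {A : Matrix n n ℂ}
    (hA : ∀ s, Commute A (F s)) : Commute A F' := by
  ext a b
  have h₁ := Matrix.hasDerivAt_mul_mul_apply hF A 1 a b
  have h₂ := Matrix.hasDerivAt_mul_mul_apply hF 1 A a b
  simp only [mul_one, one_mul] at h₁ h₂
  simp only [(hA _).eq] at h₁
  exact h₁.unique h₂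

/-- For a family `ρ_θ = W M_θ Wᴴ` with fixed invertible `W` and a commuting family of
positive definite matrices `M_θ`, all the right logarithmic derivatives
`Lᴿ_{θ,i} = (∂ᵢ ρ_θ) ρ_θ⁻¹` commute with each other.
(Condition (ii) implies condition (iii) in the theorem on global reverse estimation.) -/
theorem rld_commute_of_commuting_family {d m : ℕ}
    (W : Matrix (Fin d) (Fin d) ℂ) (hW : IsUnit W)
    (M : (Fin m → ℝ) → Matrix (Fin d) (Fin d) ℂ)
    (hMpos : ∀ θ, (M θ).PosDef)
    (hMdiff : ∀ a b, Differentiable ℝ (fun θ => M θ a b))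
    (hMcomm : ∀ θ₁ θ₂, M θ₁ * M θ₂ = M θ₂ * M θ₁)
    (D : Fin m → (Fin m → ℝ) → Matrix (Fin d) (Fin d) ℂ)
    (hD : ∀ i θ a b, HasDerivAt (fun t : ℝ => (W * M (θ + t • (Pi.single i 1 : Fin m → ℝ)) * Wᴴ) a b)
      (D i θ a b) 0) :
    ∀ (i j : Fin m) (θ θ' : Fin m → ℝ),
      (D i θ * (W * M θ * Wᴴ)⁻¹) * (D j θ' * (W * M θ' * Wᴴ)⁻¹)
        = (D j θ' * (W * M θ' * Wᴴ)⁻¹) * (D i θ * (W * M θ * Wᴴ)⁻¹) := by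
  have hWd : IsUnit W.det := (Matrix.isUnit_iff_isUnit_det W).mp hW
  have hWHd : IsUnit (Wᴴ).det := by
    rw [Matrix.det_conjTranspose]; exact hWd.star
  have hcancel (X : Matrix (Fin d) (Fin d) ℂ) : W⁻¹ * (W * X * Wᴴ) * (Wᴴ)⁻¹ = X := by
    rw [mul_assoc W, Matrix.nonsing_inv_mul_cancel_left _ _ hWd,
      Matrix.mul_nonsing_inv_cancel_right _ _ hWHd]
  -- The entrywise partial derivatives of `M`.
  let N (i : Fin m) (θ : Fin m → ℝ) : Matrix (Fin d) (Fin d) ℂ := W⁻¹ * D i θ * (Wᴴ)⁻¹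
  have hN (i : Fin m) (θ : Fin m → ℝ) (a b : Fin d) :
      HasDerivAt (fun t : ℝ => M (θ + t • (Pi.single i 1 : Fin m → ℝ)) a b) (N i θ a b) 0 := by
    simpa only [hcancel] using Matrix.hasDerivAt_mul_mul_apply (hD i θ) W⁻¹ (Wᴴ)⁻¹ a b
  have hMN (θ : Fin m → ℝ) (j : Fin m) (θ' : Fin m → ℝ) : Commute (M θ) (N j θ') :=
    Matrix.commute_of_hasDerivAt (hN j θ') fun _ => hMcomm _ _
  have hNN (i : Fin m) (θ : Fin m → ℝ) (j : Fin m) (θ' : Fin m → ℝ) :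
      Commute (N i θ) (N j θ') :=
    Matrix.commute_of_hasDerivAt (hN j θ') fun _ => (hMN _ i θ).symm
  have hinv {X : Matrix (Fin d) (Fin d) ℂ} {θ : Fin m → ℝ} (h : Commute X (M θ)) :
      Commute X (M θ)⁻¹ := by
    obtain ⟨u, hu⟩ := (hMpos θ).isUnit
    rw [← hu] at h ⊢
    rw [← Matrix.coe_units_inv]
    exact h.units_inv_right
  have hL (i : Fin m) (θ : Fin m → ℝ) :
      D i θ * (W * M θ * Wᴴ)⁻¹ = W * (N i θ * (M θ)⁻¹) * W⁻¹ := by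
    simp only [N, Matrix.mul_inv_rev, ← mul_assoc, Matrix.mul_nonsing_inv _ hWd, one_mul]
  intro i j θ θ'
  have hcomm : Commute (N i θ * (M θ)⁻¹) (N j θ' * (M θ')⁻¹) :=
    ((hNN i θ j θ').mul_right (hinv (hMN θ' i θ).symm)).mul_left
      ((hinv (hMN θ j θ').symm).symm.mul_right
        (hinv (hinv (hMcomm θ' θ)).symm))
  have hconj (X Y : Matrix (Fin d) (Fin d) ℂ) :
      W * X * W⁻¹ * (W * Y * W⁻¹) = W * (X * Y) * W⁻¹ := by
    simp only [mul_assoc, Matrix.nonsing_inv_mul_cancel_left _ _ hWd]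
  rw [hL, hL, hconj, hconj, hcomm.eq]
end
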